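/- The persistence distance fails the triangle inequality: there exist m ∈ ℕ and finite real sequences y, z ∈ ℝ^{m+1} such that ‖y + z‖_per > ‖y‖_per + ‖z‖_per. Consequently, the persistence distance ‖·‖_per is not a convex functional (and not a seminorm) on ℝ^{m+1}. -/

import Mathlib

/-- `x_l` is a (left-sided) local minimum knot of the sequence `y 0, …, y m`. -/
def IsLocalMinKnot (m : ℕ) (y : ℕ → ℝ) (l : ℕ) : Prop :=
  (l = 0 ∧ ∃ ν : ℕ, ν + 1 ≤ m ∧ (∀ i ≤ ν, y i = y 0) ∧ y 0 < y (ν + 1)) ∨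
  (0 < l ∧ l < m ∧ y (l - 1) > y l ∧
    ∃ ν : ℕ, l + ν + 1 ≤ m ∧ (∀ i, l ≤ i → i ≤ l + ν → y i = y l) ∧ y l < y (l + ν + 1)) ∨
  (l = m ∧ 0 < m ∧ y (m - 1) > y m)

/-- `x_l` is a (left-sided) local maximum knot of the sequence `y 0, …, y m`. -/
def IsLocalMaxKnot (m : ℕ) (y : ℕ → ℝ) (l : ℕ) : Prop :=
  (l = 0 ∧ ∃ ν : ℕ, ν + 1 ≤ m ∧ (∀ i ≤ ν, y i = y 0) ∧ y 0 > y (ν + 1)) ∨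
  (0 < l ∧ l < m ∧ y (l - 1) < y l ∧
    ∃ ν : ℕ, l + ν + 1 ≤ m ∧ (∀ i, l ≤ i → i ≤ l + ν → y i = y l) ∧ y l > y (l + ν + 1)) ∨
  (l = m ∧ 0 < m ∧ y (m - 1) < y m)

open Classical in
/-- The list of local minimum knots, in increasing index order. -/
noncomputable def minKnotList (m : ℕ) (y : ℕ → ℝ) : List ℕ :=
  (List.range (m + 1)).filter fun l => decide (IsLocalMinKnot m y l)

open Classical in
/-- The list of local maximum knots, in increasing index order. -/
noncomputable def maxKnotList (m : ℕ) (y : ℕ → ℝ) : List ℕ :=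
  (List.range (m + 1)).filter fun l => decide (IsLocalMaxKnot m y l)

open Classical in
/-- Local maximum knots sorted by increasing value, ties broken by smaller index. -/
noncomputable def sortedMaxKnots (m : ℕ) (y : ℕ → ℝ) : List ℕ :=
  (maxKnotList m y).mergeSort fun a b => decide (y a < y b ∨ (y a = y b ∧ a ≤ b))

/-- `I_max`: the extremum knot of highest index (`0` if there is no extremum knot). -/
noncomputable def imaxKnot (m : ℕ) (y : ℕ → ℝ) : ℕ :=
  ((minKnotList m y ++ maxKnotList m y).max?).getD 0

open Classical in
/-- One step of the persistence pairing algorithm (Algorithm 2): process the local maximum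
knot `k`, pairing it with the neighbouring remaining local minimum knot whose value is
closer (ties broken by the larger knot), and remove that minimum from the remaining list. -/
noncomputable def pairStep (y : ℕ → ℝ) (imax : ℕ)
    (acc : List (ℕ × ℕ) × List ℕ) (k : ℕ) : List (ℕ × ℕ) × List ℕ :=
  if k = 0 ∨ k = imax then acc
  else
    match (acc.2.filter fun j => decide (j < k)).max?,
          (acc.2.filter fun j => decide (k < j)).min? with
    | none, none => acc
    | some a, none => ((a, k) :: acc.1, acc.2.erase a)
    | none, some b => ((k, b) :: acc.1, acc.2.erase b)
    | some a, some b =>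
        if |y k - y a| < |y k - y b| then ((a, k) :: acc.1, acc.2.erase a)
        else ((k, b) :: acc.1, acc.2.erase b)

/-- The multiset `P₁` of persistence pairs of `y` produced by Algorithm 2,
as a list of pairs of knots (each pair ordered by knot index). -/
noncomputable def pairsP1 (m : ℕ) (y : ℕ → ℝ) : List (ℕ × ℕ) :=
  ((sortedMaxKnots m y).foldl (pairStep y (imaxKnot m y)) ([], minKnotList m y)).1

/-- The persistence distance `‖y‖_per`: the sum of the distances of function values over all
persistence pairs in `P₁` (pairs of `y`) and `P₂` (pairs of `-y`). -/
noncomputable def perDist (m : ℕ) (y : ℕ → ℝ) : ℝ :=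
  ((pairsP1 m y).map fun p => |y p.2 - y p.1|).sum +
  ((pairsP1 m fun i => -(y i)).map fun p => |y p.2 - y p.1|).sum

/-- The discrete total variation `TV(y) = ∑_{j=0}^{m-1} |y_{j+1} - y_j|`. -/
noncomputable def discreteTV (m : ℕ) (y : ℕ → ℝ) : ℝ :=
  ∑ j ∈ Finset.range m, |y (j + 1) - y j|

/-- The range `max_{0 ≤ j,k ≤ m} |y_j - y_k|` of the sequence `y 0, …, y m`. -/
noncomputable def seqRange (m : ℕ) (y : ℕ → ℝ) : ℝ :=
  ((Finset.range (m + 1)) ×ˢ (Finset.range (m + 1))).sup'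
    (Finset.Nonempty.product ⟨0, Finset.mem_range.mpr (Nat.succ_pos m)⟩
      ⟨0, Finset.mem_range.mpr (Nat.succ_pos m)⟩)
    fun p => |y p.1 - y p.2|

theorem foldl_pairStep_eq_self (y : ℕ → ℝ) (imax : ℕ) (l : List ℕ)
    (h : ∀ k ∈ l, k = 0 ∨ k = imax) (acc : List (ℕ × ℕ) × List ℕ) :
    l.foldl (pairStep y imax) acc = acc := by
  induction l generalizing acc with
  | nil => rfl
  | cons k l ih =>
    have hk : pairStep y imax acc k = acc := if_pos (h k (by simp))
    rw [List.foldl_cons, hk, ih fun j hj => h j (by simp [hj])]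

theorem mem_minKnotList {m : ℕ} {y : ℕ → ℝ} {l : ℕ} :
    l ∈ minKnotList m y ↔ l ≤ m ∧ IsLocalMinKnot m y l := by
  simp [minKnotList]

theorem mem_maxKnotList {m : ℕ} {y : ℕ → ℝ} {l : ℕ} :
    l ∈ maxKnotList m y ↔ l ≤ m ∧ IsLocalMaxKnot m y l := by
  simp [maxKnotList]

theorem mem_sortedMaxKnots {m : ℕ} {y : ℕ → ℝ} {l : ℕ} :
    l ∈ sortedMaxKnots m y ↔ l ≤ m ∧ IsLocalMaxKnot m y l := by
  simp [sortedMaxKnots, mem_maxKnotList]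

theorem imaxKnot_eq_of_isLocalMaxKnot {m : ℕ} {y : ℕ → ℝ} (h : IsLocalMaxKnot m y m) :
    imaxKnot m y = m := by
  have : (minKnotList m y ++ maxKnotList m y).max? = some m := by
    rw [List.max?_eq_some_iff]
    refine ⟨List.mem_append_right _ (mem_maxKnotList.2 ⟨le_rfl, h⟩), fun b hb => ?_⟩
    rcases List.mem_append.1 hb with hb | hb
    · exact (mem_minKnotList.1 hb).1
    · exact (mem_maxKnotList.1 hb).1
  simp [imaxKnot, this]

theorem pairsP1_eq_nil_of_isLocalMaxKnot {m : ℕ} {y : ℕ → ℝ}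
    (h : ∀ k, IsLocalMaxKnot m y k → k = 0 ∨ k = m) : pairsP1 m y = [] := by
  rw [pairsP1, foldl_pairStep_eq_self]
  intro k hk
  have hk := (mem_sortedMaxKnots.1 hk).2
  refine (h k hk).imp_right fun hkm => ?_
  subst hkm
  exact (imaxKnot_eq_of_isLocalMaxKnot hk).symm

theorem pairsP1_eq_nil_of_strictMono {m : ℕ} {y : ℕ → ℝ} (hy : StrictMono y) :
    pairsP1 m y = [] := by
  refine pairsP1_eq_nil_of_isLocalMaxKnot fun k hk => ?_
  rcases hk with hk | ⟨-, -, -, ν, -, -, hν⟩ | hk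
  · exact .inl hk.1
  · exact absurd hν (hy (by omega)).not_gt
  · exact .inr hk.1

theorem pairsP1_eq_nil_of_strictAnti {m : ℕ} {y : ℕ → ℝ} (hy : StrictAnti y) :
    pairsP1 m y = [] := by
  refine pairsP1_eq_nil_of_isLocalMaxKnot fun k hk => ?_
  rcases hk with hk | ⟨h0, -, hlt, -⟩ | hk
  · exact .inl hk.1
  · exact absurd hlt (hy (by omega)).not_gt
  · exact .inr hk.1

theorem perDist_eq_zero_of_strictMono {m : ℕ} {y : ℕ → ℝ} (hy : StrictMono y) :
    perDist m y = 0 := by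
  simp [perDist, pairsP1_eq_nil_of_strictMono hy, pairsP1_eq_nil_of_strictAnti hy.neg]

theorem perDist_eq_zero_of_strictAnti {m : ℕ} {y : ℕ → ℝ} (hy : StrictAnti y) :
    perDist m y = 0 := by
  simp [perDist, pairsP1_eq_nil_of_strictAnti hy, pairsP1_eq_nil_of_strictMono hy.neg]

theorem minKnotList_two_of_peak {y : ℕ → ℝ} (h01 : y 0 < y 1) (h21 : y 2 < y 1) :
    minKnotList 2 y = [0, 2] := by
  have h0 : IsLocalMinKnot 2 y 0 := .inl ⟨rfl, 0, by simp, by simp, h01⟩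
  have h1 : ¬ IsLocalMinKnot 2 y 1 := by
    simp [IsLocalMinKnot, h01.le]
  have h2 : IsLocalMinKnot 2 y 2 := .inr (.inr ⟨rfl, by simp, h21⟩)
  simp [minKnotList, List.range_succ, h0, h1, h2]

theorem maxKnotList_two_of_peak {y : ℕ → ℝ} (h01 : y 0 < y 1) (h21 : y 2 < y 1) :
    maxKnotList 2 y = [1] := by
  have h0 : ¬ IsLocalMaxKnot 2 y 0 := by
    rintro (⟨-, ν, hν, hc, hlt⟩ | ⟨h, -⟩ | ⟨h, -⟩)
    · obtain rfl | rfl : ν = 0 ∨ ν = 1 := by omega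
      · exact h01.not_gt hlt
      · exact h01.ne' (hc 1 le_rfl)
    · exact h.false
    · exact absurd h (by simp)
  have h1 : IsLocalMaxKnot 2 y 1 :=
    .inr (.inl ⟨by simp, by simp, h01, 0, by simp,
      fun i hi hi' => by rw [le_antisymm hi' hi], h21⟩)
  have h2 : ¬ IsLocalMaxKnot 2 y 2 := by
    simp [IsLocalMaxKnot, h21.le]
  simp [maxKnotList, List.range_succ, h0, h1, h2]

theorem pairsP1_two_of_peak {y : ℕ → ℝ} (h01 : y 0 < y 1) (h21 : y 2 < y 1) (h02 : y 0 = y 2) :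
    pairsP1 2 y = [(1, 2)] := by
  have himax : imaxKnot 2 y = 2 := by
    simp [imaxKnot, minKnotList_two_of_peak h01 h21, maxKnotList_two_of_peak h01 h21, List.max?]
  simp [pairsP1, sortedMaxKnots, himax, minKnotList_two_of_peak h01 h21,
    maxKnotList_two_of_peak h01 h21, pairStep, h02, List.max?, List.min?]

theorem perDist_two_pos_of_peak {y : ℕ → ℝ} (h01 : y 0 < y 1) (h21 : y 2 < y 1)
    (h02 : y 0 = y 2) : 0 < perDist 2 y := by
  refine add_pos_of_pos_of_nonneg ?_ (List.sum_nonneg ?_)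
  · simpa [pairsP1_two_of_peak h01 h21 h02, sub_eq_zero] using h21.ne
  · simp only [List.mem_map]
    rintro _ ⟨p, -, rfl⟩
    exact abs_nonneg _

/-- the persistence distance fails the triangle inequality: there are `m` and
sequences `y, z ∈ ℝ^{m+1}` with `‖y + z‖_per > ‖y‖_per + ‖z‖_per`; consequently `‖·‖_per`
is not a convex functional. -/
theorem perDist_not_triangle_and_not_convex :
    (∃ (m : ℕ) (y z : ℕ → ℝ),
      perDist m y + perDist m z < perDist m fun i => y i + z i) ∧
    (∃ m : ℕ, ¬ ConvexOn ℝ Set.univ fun y : ℕ → ℝ => perDist m y) := by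
  have hmono : ∀ c : ℝ, 0 < c → StrictMono fun i : ℕ => c * (2 * (i : ℝ)) := by
    intro c hc a b hab
    have : (a : ℝ) < b := by exact_mod_cast hab
    dsimp only
    gcongr
  have hanti : ∀ c : ℝ, 0 < c → StrictAnti fun i : ℕ => c * -(i : ℝ) ^ 2 := by
    intro c hc a b hab
    have : (a : ℝ) < b := by exact_mod_cast hab
    dsimp only
    gcongr
  refine ⟨⟨2, fun i => 1 * (2 * (i : ℝ)), fun i => 1 * -(i : ℝ) ^ 2, ?_⟩, 2, fun h => ?_⟩
  · rw [perDist_eq_zero_of_strictMono (hmono 1 one_pos),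
      perDist_eq_zero_of_strictAnti (hanti 1 one_pos), add_zero]
    apply perDist_two_pos_of_peak <;> norm_num
  · have hle := h.2 (Set.mem_univ fun i : ℕ => (2 : ℝ) * (2 * (i : ℝ)))
      (Set.mem_univ fun i : ℕ => (2 : ℝ) * -(i : ℝ) ^ 2)
      (one_half_pos (α := ℝ)).le (one_half_pos (α := ℝ)).le (add_halves 1)
    dsimp only at hle
    rw [perDist_eq_zero_of_strictMono (hmono 2 two_pos),
      perDist_eq_zero_of_strictAnti (hanti 2 two_pos), smul_zero, add_zero] at hle
    refine hle.not_gt (perDist_two_pos_of_peak ?_ ?_ ?_) <;> norm_num
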